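/- arXiv:2504.06760 — 8 statements merged into one kernel-verified Lean document; each statement's English description precedes it below -/
import Mathlib

section
/- Let 0 → V → E → P → 0 be an abelian extension of a Poisson algebra (P, ·, {,}) by a representation (V, μ, ρ), and let s be a linear section of p. If a pair (β, α) ∈ Aut(V) × Aut(P) of Poisson algebra automorphisms is inducible, then β(μ_x v) = μ_{α(x)} β(v) and β(ρ_x v) = ρ_{α(x)} β(v) for all x ∈ P and v ∈ V. -/
/-- A Poisson algebra structure on a `k`-vector space `P`: a commutative associative
bilinear multiplication `mul` and a Lie bracket `bra` satisfying the Leibniz rule. -/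
structure PoissonStruct (k P : Type*) [Field k] [AddCommGroup P] [Module k P] where
  mul : P →ₗ[k] P →ₗ[k] P
  bra : P →ₗ[k] P →ₗ[k] P
  mul_comm : ∀ x y, mul x y = mul y x
  mul_assoc : ∀ x y z, mul (mul x y) z = mul x (mul y z)
  bra_alt : ∀ x, bra x x = 0
  jacobi : ∀ x y z, bra x (bra y z) + bra y (bra z x) + bra z (bra x y) = 0
  leibniz : ∀ x y z, bra x (mul y z) = mul (bra x y) z + mul y (bra x z)

/-- A representation `(V, μ, ρ)` of a Poisson algebra `(P, mul, bra)`. -/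
structure PoissonRep (k P V : Type*) [Field k] [AddCommGroup P] [Module k P]
    [AddCommGroup V] [Module k V] (S : PoissonStruct k P) where
  μ : P →ₗ[k] Module.End k V
  ρ : P →ₗ[k] Module.End k V
  rep_mul : ∀ x y, μ (S.mul x y) = μ x * μ y
  rep_bra : ∀ x y, ρ (S.bra x y) = ρ x * ρ y - ρ y * ρ x
  compat_mu : ∀ x y, μ (S.bra x y) = ρ x * μ y - μ y * ρ x
  compat_rho : ∀ x y, ρ (S.mul x y) = μ x * ρ y + μ y * ρ x

/-- The pair of binary operations `(m, b)` satisfies all the axioms of a Poisson algebra: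
`m` is commutative and associative, `b` is alternating and satisfies the Jacobi identity,
and the Leibniz rule holds. -/
def IsPoissonOps {Q : Type*} [AddCommGroup Q] (m b : Q → Q → Q) : Prop :=
  (∀ x y, m x y = m y x) ∧ (∀ x y z, m (m x y) z = m x (m y z)) ∧
  (∀ x, b x x = 0) ∧
  (∀ x y z, b x (b y z) + b y (b z x) + b z (b x y) = 0) ∧
  (∀ x y z, b x (m y z) = m (b x y) z + m y (b x z))

/-- `(h, H)` is a Poisson 2-cocycle of `(P, S)` with coefficients in `(V, μ, ρ)`. -/
def IsCocycle2 {k P V : Type*} [Field k] [AddCommGroup P] [Module k P]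
    [AddCommGroup V] [Module k V] (S : PoissonStruct k P)
    (μ ρ : P →ₗ[k] Module.End k V) (h H : P →ₗ[k] P →ₗ[k] V) : Prop :=
  (∀ x y, h x y = h y x) ∧ (∀ x, H x x = 0) ∧
  (∀ x y z, μ x (h y z) - h (S.mul x y) z + h x (S.mul y z) - μ z (h x y) = 0) ∧
  (∀ x y z, ρ x (H y z) + ρ y (H z x) + ρ z (H x y)
      + H x (S.bra y z) + H y (S.bra z x) + H z (S.bra x y) = 0) ∧
  (∀ x y z, ρ x (h y z) - h (S.bra x y) z - h y (S.bra x z)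
      + H x (S.mul y z) - μ y (H x z) - μ z (H x y) = 0)

/-- Two Poisson 2-cocycles `(h, H)` and `(h', H')` are cohomologous. -/
def Cohomologous2 {k P V : Type*} [Field k] [AddCommGroup P] [Module k P]
    [AddCommGroup V] [Module k V] (S : PoissonStruct k P)
    (μ ρ : P →ₗ[k] Module.End k V) (h H h' H' : P →ₗ[k] P →ₗ[k] V) : Prop :=
  ∃ φ : P →ₗ[k] V, ∀ x y,
    h x y - h' x y = μ x (φ y) - φ (S.mul x y) + μ y (φ x) ∧
    H x y - H' x y = ρ x (φ y) - φ (S.bra x y) - ρ y (φ x)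

/-- `d` is a Poisson derivation of the Poisson algebra `(P, S)`. -/
def IsPoissonDer {k P : Type*} [Field k] [AddCommGroup P] [Module k P]
    (S : PoissonStruct k P) (d : P →ₗ[k] P) : Prop :=
  (∀ x y, d (S.mul x y) = S.mul (d x) y + S.mul x (d y)) ∧
  (∀ x y, d (S.bra x y) = S.bra (d x) y + S.bra x (d y))

/-- `r` is a Rota-Baxter operator of weight 1 on the Poisson algebra `(P, S)`. -/
def IsRBW1 {k P : Type*} [Field k] [AddCommGroup P] [Module k P]
    (S : PoissonStruct k P) (r : P →ₗ[k] P) : Prop :=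
  (∀ x y, S.mul (r x) (r y) = r (S.mul x y + S.mul (r x) y + S.mul x (r y))) ∧
  (∀ x y, S.bra (r x) (r y) = r (S.bra x y + S.bra (r x) y + S.bra x (r y)))

/-- `r` is a modified Rota-Baxter operator on the Poisson algebra `(P, S)`. -/
def IsModRB {k P : Type*} [Field k] [AddCommGroup P] [Module k P]
    (S : PoissonStruct k P) (r : P →ₗ[k] P) : Prop :=
  (∀ x y, S.mul (r x) (r y) = r (S.mul (r x) y + S.mul x (r y)) - S.mul x y) ∧
  (∀ x y, S.bra (r x) (r y) = r (S.bra (r x) y + S.bra x (r y)) - S.bra x y)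

/-- A bilinear operation `B` on `E` that vanishes on the image of `V` has a well-defined action
of `E / V` on `V`: `B e (i v)` depends on `e` only through its class `p e`. -/
theorem bilin_eq_of_proj_eq {k P V E : Type*} [Field k]
    [AddCommGroup P] [Module k P] [AddCommGroup V] [Module k V] [AddCommGroup E] [Module k E]
    (B : E →ₗ[k] E →ₗ[k] E) {i : V →ₗ[k] E} {p : E →ₗ[k] P}
    (hexact : LinearMap.range i = LinearMap.ker p) (hB : ∀ u v : V, B (i u) (i v) = 0)
    {e e' : E} (h : p e = p e') (v : V) : B e (i v) = B e' (i v) := by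
  have hmem : e - e' ∈ LinearMap.range i := by
    rw [hexact, LinearMap.mem_ker, map_sub, h, sub_self]
  obtain ⟨u, hu⟩ := hmem
  rw [← sub_eq_zero, ← LinearMap.sub_apply, ← map_sub, ← hu, hB]

/-- If `γ` preserves `B`, restricts to `β` on `V` and induces `α` on the quotient `P`, then
`β` intertwines the action of `P` on `V` given by `B` with its twist by `α`. -/
theorem map_action_of_map_bilin {k P V E : Type*} [Field k]
    [AddCommGroup P] [Module k P] [AddCommGroup V] [Module k V] [AddCommGroup E] [Module k E]
    (B : E →ₗ[k] E →ₗ[k] E) {i : V →ₗ[k] E} {p : E →ₗ[k] P} (hi : Function.Injective i)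
    (hexact : LinearMap.range i = LinearMap.ker p) (hB : ∀ u v : V, B (i u) (i v) = 0)
    {s : P → E} {act : P → Module.End k V} (hact : ∀ x v, i (act x v) = B (s x) (i v))
    {γ : E → E} {β : V → V} {α : P → P} (hγB : ∀ e e', γ (B e e') = B (γ e) (γ e'))
    (hγi : ∀ u, γ (i u) = i (β u)) (hγs : ∀ x, p (γ (s x)) = p (s (α x))) (x : P) (v : V) :
    β (act x v) = act (α x) (β v) := by
  apply hi
  rw [← hγi, hact, hγB, hγi, hact, bilin_eq_of_proj_eq B hexact hB (hγs x)]

/-- In an abelian extension `0 → V → E → P → 0`, if a pair `(β, α)` of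
Poisson algebra automorphisms is inducible then `β (μ_x v) = μ_{α x} (β v)` and
`β (ρ_x v) = ρ_{α x} (β v)`. -/
theorem inducible_automorphism_necessary
    {k P V E : Type*} [Field k] [CharZero k]
    [AddCommGroup P] [Module k P] [AddCommGroup V] [Module k V]
    [AddCommGroup E] [Module k E]
    (SP : PoissonStruct k P) (SE : PoissonStruct k E)
    (R : PoissonRep k P V SP)
    (i : V →ₗ[k] E) (p : E →ₗ[k] P)
    (hi : Function.Injective i) (hp : Function.Surjective p)
    (hexact : LinearMap.range i = LinearMap.ker p)
    (himul : ∀ u v : V, SE.mul (i u) (i v) = 0)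
    (hibra : ∀ u v : V, SE.bra (i u) (i v) = 0)
    (hpmul : ∀ e e' : E, p (SE.mul e e') = SP.mul (p e) (p e'))
    (hpbra : ∀ e e' : E, p (SE.bra e e') = SP.bra (p e) (p e'))
    (s : P →ₗ[k] E) (hs : ∀ x, p (s x) = x)
    (hact_mu : ∀ (x : P) (v : V), i (R.μ x v) = SE.mul (s x) (i v))
    (hact_rho : ∀ (x : P) (v : V), i (R.ρ x v) = SE.bra (s x) (i v))
    (β : V ≃ₗ[k] V) (α : P ≃ₗ[k] P)
    (hαmul : ∀ x y, α (SP.mul x y) = SP.mul (α x) (α y))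
    (hαbra : ∀ x y, α (SP.bra x y) = SP.bra (α x) (α y))
    (hind : ∃ γ : E ≃ₗ[k] E,
        (∀ e e', γ (SE.mul e e') = SE.mul (γ e) (γ e')) ∧
        (∀ e e', γ (SE.bra e e') = SE.bra (γ e) (γ e')) ∧
        (∀ u, γ (i u) = i (β u)) ∧ (∀ x, p (γ (s x)) = α x)) :
    (∀ (x : P) (v : V), β (R.μ x v) = R.μ (α x) (β v)) ∧
    (∀ (x : P) (v : V), β (R.ρ x v) = R.ρ (α x) (β v)) := by
  obtain ⟨γ, hγmul, hγbra, hγi, hγp⟩ := hind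
  have hγs : ∀ x, p (γ (s x)) = p (s (α x)) := fun x => by rw [hγp, hs]
  exact ⟨map_action_of_map_bilin SE.mul hi hexact himul hact_mu (fun e e' => hγmul e e') hγi hγs,
    map_action_of_map_bilin SE.bra hi hexact hibra hact_rho (fun e e' => hγbra e e') hγi hγs⟩
end

section
/- Let 0 → V → E → P → 0 be an abelian extension of a Poisson algebra (P, ·, {,}) by a representation (V, μ, ρ), let s be a linear section of p, and let (h, H) be the Poisson 2-cocycle induced by s, i.e. h(x,y) = s(x) ·_E s(y) − s(x·y) and H(x,y) = {s(x), s(y)}_E − s({x,y}). Then a pair (β, α) ∈ Aut(V) × Aut(P) of Poisson algebra automorphisms is inducible if and only if β(μ_x v) = μ_{α(x)} β(v) and β(ρ_x v) = ρ_{α(x)} β(v) for all x ∈ P, v ∈ V, and the Poisson 2-cocycles (h_{(β,α)}, H_{(β,α)}) and (h, H) are cohomologous, where h_{(β,α)}(x,y) := β(h(α⁻¹(x), α⁻¹(y))) and H_{(β,α)}(x,y) := β(H(α⁻¹(x), α⁻¹(y))). -/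
theorem PoissonStruct.bra_skew {k P : Type*} [Field k] [AddCommGroup P] [Module k P]
    (S : PoissonStruct k P) (x y : P) : S.bra x y = -S.bra y x := by
  have h := S.bra_alt (x + y)
  simp only [map_add, LinearMap.add_apply, S.bra_alt, zero_add, add_zero] at h
  exact eq_neg_of_add_eq_zero_right h

section SplitExtension

variable {k P V E : Type*} [Field k] [AddCommGroup P] [Module k P] [AddCommGroup V] [Module k V]
  [AddCommGroup E] [Module k E]

/-- A linear section of a short exact sequence determines the complementary retraction. -/
theorem exists_retraction_of_section (i : V →ₗ[k] E) (p : E →ₗ[k] P) (hi : Function.Injective i)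
    (hexact : LinearMap.range i = LinearMap.ker p) (s : P →ₗ[k] E) (hs : ∀ x, p (s x) = x) :
    ∃ r : E →ₗ[k] V, ∀ e, i (r e) = e - s (p e) := by
  have hr (e : E) : (LinearMap.id - s ∘ₗ p : E →ₗ[k] E) e ∈ LinearMap.range i := by
    simp [hexact, hs]
  refine ⟨(LinearEquiv.ofInjective i hi).symm.toLinearMap ∘ₗ LinearMap.codRestrict _ _ hr,
    fun e => ?_⟩
  simp

/-- The linear automorphism of a split extension that is block triangular with diagonal blocks
`β` and `α` and off-diagonal block `φ ∘ α`. -/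
theorem exists_triangular_equiv (i : V →ₗ[k] E) (p : E →ₗ[k] P) (hi : Function.Injective i)
    (hexact : LinearMap.range i = LinearMap.ker p) (s : P →ₗ[k] E) (hs : ∀ x, p (s x) = x)
    (β : V ≃ₗ[k] V) (α : P ≃ₗ[k] P) (φ : P →ₗ[k] V) :
    ∃ γ : E ≃ₗ[k] E, (∀ u, γ (i u) = i (β u)) ∧ ∀ x, γ (s x) = s (α x) + i (φ (α x)) := by
  obtain ⟨r, hr⟩ := exists_retraction_of_section i p hi hexact s hs
  have hpi (u : V) : p (i u) = 0 := by
    have : i u ∈ LinearMap.ker p := hexact ▸ LinearMap.mem_range_self i u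
    exact this
  have hri (u : V) : r (i u) = u := hi (by simp [hr, hpi])
  have hrs (x : P) : r (s x) = 0 := hi (by simp [hr, hs])
  have hdecomp (e : E) : i (r e) + s (p e) = e := by simp [hr]
  refine ⟨LinearEquiv.ofLinearMap
    (i ∘ₗ β.toLinearMap ∘ₗ r + (s + i ∘ₗ φ) ∘ₗ α.toLinearMap ∘ₗ p)
    (i ∘ₗ β.symm.toLinearMap ∘ₗ (r - φ ∘ₗ p) + s ∘ₗ α.symm.toLinearMap ∘ₗ p) ?_ ?_, ?_, ?_⟩
  · ext e
    simp [hri, hrs, hpi, hs, hdecomp]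
  · ext e
    simp [hri, hrs, hpi, hs, hdecomp]
  · intro u
    simp [hri, hpi]
  · intro x
    simp [hrs, hs]

/-- A block triangular map of a split extension preserves a bilinear operation `B` if and only if
its diagonal blocks intertwine the action `a` and its off-diagonal block trivializes the change
of the cocycle `c`. The unit `ε` relates the left and the right action. -/
theorem triangular_preserves_iff (i : V →ₗ[k] E) (p : E →ₗ[k] P) (hi : Function.Injective i)
    (hexact : LinearMap.range i = LinearMap.ker p) (s : P →ₗ[k] E) (hs : ∀ x, p (s x) = x)
    (B : E →ₗ[k] E →ₗ[k] E) (b : P →ₗ[k] P →ₗ[k] P) (a : P →ₗ[k] Module.End k V) (ε : ℤ)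
    (hB : ∀ u v, B (i u) (i v) = 0) (hleft : ∀ x v, i (a x v) = B (s x) (i v))
    (hright : ∀ x v, B (i v) (s x) = ε • B (s x) (i v))
    (c : P → P → V) (hc : ∀ x y, i (c x y) = B (s x) (s y) - s (b x y))
    (β : V ≃ₗ[k] V) (α : P ≃ₗ[k] P) (hα : ∀ x y, α (b x y) = b (α x) (α y))
    (φ : P →ₗ[k] V) (γ : E →ₗ[k] E) (hγi : ∀ u, γ (i u) = i (β u))
    (hγs : ∀ x, γ (s x) = s (α x) + i (φ (α x))) :
    (∀ e e', γ (B e e') = B (γ e) (γ e')) ↔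
      (∀ x v, β (a x v) = a (α x) (β v)) ∧
      ∀ x y, β (c (α.symm x) (α.symm y)) - c x y = a x (φ y) - φ (b x y) + ε • a y (φ x) := by
  have hss (x y : P) : B (s x) (s y) = s (b x y) + i (c x y) := by simp [hc]
  have key (x y : P) : γ (B (s x) (s y)) = B (γ (s x)) (γ (s y)) ↔
      β (c x y) - c (α x) (α y) =
        a (α x) (φ (α y)) - φ (b (α x) (α y)) + ε • a (α y) (φ (α x)) := by
    rw [← hi.eq_iff, hγs, hγs, hss, map_add, hγs, hγi, hα]
    simp only [map_add, map_sub, map_zsmul, LinearMap.add_apply, hB, hright, ← hleft, hss]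
    constructor <;> intro h <;> linear_combination (norm := module) h
  have keyl (x : P) (v : V) : γ (B (s x) (i v)) = B (γ (s x)) (γ (i v)) ↔
      β (a x v) = a (α x) (β v) := by
    rw [← hleft, hγs, hγi, hγi, map_add, LinearMap.add_apply, hB, ← hleft, add_zero, hi.eq_iff]
  constructor
  · intro hγ
    refine ⟨fun x v => (keyl x v).1 (hγ _ _), fun x y => ?_⟩
    simpa using (key (α.symm x) (α.symm y)).1 (hγ _ _)
  · rintro ⟨ha, hφ⟩
    have hsi (x : P) (v : V) := (keyl x v).2 (ha x v)
    have his (v : V) (x : P) : γ (B (i v) (s x)) = B (γ (i v)) (γ (s x)) := by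
      rw [hright, map_zsmul, hsi, hγi, hγs]
      simp [hB, hright]
    have hsp (x y : P) : γ (B (s x) (s y)) = B (γ (s x)) (γ (s y)) :=
      (key x y).2 (by simpa using hφ (α x) (α y))
    obtain ⟨r, hr⟩ := exists_retraction_of_section i p hi hexact s hs
    intro e e'
    rw [← sub_add_cancel e (s (p e)), ← sub_add_cancel e' (s (p e')), ← hr, ← hr]
    simp only [map_add, LinearMap.add_apply, hsi, his, hsp]
    simp only [hB, hγi, map_zero]

end SplitExtension

/-- A pair `(β, α)` of Poisson automorphisms is inducible iff it is
compatible with the representation and the transformed 2-cocycle `(h_{(β,α)}, H_{(β,α)})`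
is cohomologous to `(h, H)`. -/
theorem inducible_automorphism_iff
    {k P V E : Type*} [Field k] [CharZero k]
    [AddCommGroup P] [Module k P] [AddCommGroup V] [Module k V]
    [AddCommGroup E] [Module k E]
    (SP : PoissonStruct k P) (SE : PoissonStruct k E)
    (R : PoissonRep k P V SP)
    (i : V →ₗ[k] E) (p : E →ₗ[k] P)
    (hi : Function.Injective i) (hp : Function.Surjective p)
    (hexact : LinearMap.range i = LinearMap.ker p)
    (himul : ∀ u v : V, SE.mul (i u) (i v) = 0)
    (hibra : ∀ u v : V, SE.bra (i u) (i v) = 0)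
    (hpmul : ∀ e e' : E, p (SE.mul e e') = SP.mul (p e) (p e'))
    (hpbra : ∀ e e' : E, p (SE.bra e e') = SP.bra (p e) (p e'))
    (s : P →ₗ[k] E) (hs : ∀ x, p (s x) = x)
    (hact_mu : ∀ (x : P) (v : V), i (R.μ x v) = SE.mul (s x) (i v))
    (hact_rho : ∀ (x : P) (v : V), i (R.ρ x v) = SE.bra (s x) (i v))
    (h H : P → P → V)
    (hdef : ∀ x y, i (h x y) = SE.mul (s x) (s y) - s (SP.mul x y))
    (Hdef : ∀ x y, i (H x y) = SE.bra (s x) (s y) - s (SP.bra x y))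
    (β : V ≃ₗ[k] V) (α : P ≃ₗ[k] P)
    (hαmul : ∀ x y, α (SP.mul x y) = SP.mul (α x) (α y))
    (hαbra : ∀ x y, α (SP.bra x y) = SP.bra (α x) (α y)) :
    (∃ γ : E ≃ₗ[k] E,
        (∀ e e', γ (SE.mul e e') = SE.mul (γ e) (γ e')) ∧
        (∀ e e', γ (SE.bra e e') = SE.bra (γ e) (γ e')) ∧
        (∀ u, γ (i u) = i (β u)) ∧ (∀ x, p (γ (s x)) = α x)) ↔
    ((∀ (x : P) (v : V), β (R.μ x v) = R.μ (α x) (β v)) ∧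
     (∀ (x : P) (v : V), β (R.ρ x v) = R.ρ (α x) (β v)) ∧
     ∃ φ : P →ₗ[k] V, ∀ x y,
        β (h (α.symm x) (α.symm y)) - h x y
          = R.μ x (φ y) - φ (SP.mul x y) + R.μ y (φ x) ∧
        β (H (α.symm x) (α.symm y)) - H x y
          = R.ρ x (φ y) - φ (SP.bra x y) - R.ρ y (φ x)) := by
  have hmr (x : P) (v : V) : SE.mul (i v) (s x) = (1 : ℤ) • SE.mul (s x) (i v) := by
    rw [one_smul, SE.mul_comm]
  have hbr (x : P) (v : V) : SE.bra (i v) (s x) = (-1 : ℤ) • SE.bra (s x) (i v) := by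
    rw [neg_one_smul, SE.bra_skew]
  have hmul := triangular_preserves_iff i p hi hexact s hs SE.mul SP.mul R.μ 1 himul hact_mu hmr
    h hdef β α hαmul
  have hbra := triangular_preserves_iff i p hi hexact s hs SE.bra SP.bra R.ρ (-1) hibra hact_rho
    hbr H Hdef β α hαbra
  simp only [one_smul, neg_one_smul, ← sub_eq_add_neg] at hmul hbra
  constructor
  · rintro ⟨γ, hγm, hγb, hγi, hγp⟩
    obtain ⟨r, hr⟩ := exists_retraction_of_section i p hi hexact s hs
    let φ : P →ₗ[k] V := r ∘ₗ γ.toLinearMap ∘ₗ s ∘ₗ α.symm.toLinearMap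
    have hγs (x : P) : γ.toLinearMap (s x) = s (α x) + i (φ (α x)) := by simp [φ, hr, hγp]
    obtain ⟨hμ, hφm⟩ := (hmul φ γ.toLinearMap hγi hγs).1 hγm
    obtain ⟨hρ, hφb⟩ := (hbra φ γ.toLinearMap hγi hγs).1 hγb
    exact ⟨hμ, hρ, φ, fun x y => ⟨hφm x y, hφb x y⟩⟩
  · rintro ⟨hμ, hρ, φ, hφ⟩
    obtain ⟨γ, hγi, hγs⟩ := exists_triangular_equiv i p hi hexact s hs β α φ
    refine ⟨γ, (hmul φ γ.toLinearMap hγi hγs).2 ⟨hμ, fun x y => (hφ x y).1⟩,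
      (hbra φ γ.toLinearMap hγi hγs).2 ⟨hρ, fun x y => (hφ x y).2⟩, hγi, fun x => ?_⟩
    have hpi : i (φ (α x)) ∈ LinearMap.ker p := hexact ▸ LinearMap.mem_range_self i _
    rw [hγs, map_add, hs, LinearMap.mem_ker.1 hpi, add_zero]
end

section
/- Let 0 → V → E → P → 0 be an abelian extension of a Poisson algebra (P, ·, {,}) by a representation (V, μ, ρ), and let s be a linear section of p. If a pair (d_V, d_P) ∈ Der(V) × Der(P) of Poisson derivations is inducible, then d_V(μ_x v) = μ_{d_P(x)} v + μ_x d_V(v) and d_V(ρ_x v) = ρ_{d_P(x)} v + ρ_x d_V(v) for all x ∈ P and v ∈ V. -/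
/-- If a linear map `d` of `E` preserves the image of `V`, is a derivation of a bilinear operation
`B` which vanishes on that image, and induces `dP` on `P`, then `dV`, the restriction of `d` to `V`,
is compatible with the action `A` of `P` on `V` defined by `B` through a section. -/
lemma restrict_apply_action_of_derivation {k P V E : Type*} [CommRing k]
    [AddCommGroup P] [Module k P] [AddCommGroup V] [Module k V] [AddCommGroup E] [Module k E]
    {B : E →ₗ[k] E →ₗ[k] E} {A : P →ₗ[k] Module.End k V} {i : V →ₗ[k] E} {p : E →ₗ[k] P}
    (hi : Function.Injective i) (hexact : LinearMap.range i = LinearMap.ker p)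
    (hB : ∀ u v : V, B (i u) (i v) = 0)
    {s : P →ₗ[k] E} (hs : ∀ x, p (s x) = x) (hA : ∀ x v, i (A x v) = B (s x) (i v))
    {dV : V →ₗ[k] V} {dP : P →ₗ[k] P} {d : E →ₗ[k] E}
    (hd : ∀ e e', d (B e e') = B (d e) e' + B e (d e'))
    (hdV : ∀ u, d (i u) = i (dV u)) (hdP : ∀ x, p (d (s x)) = dP x) (x : P) (v : V) :
    dV (A x v) = A (dP x) v + A x (dV v) := by
  obtain ⟨w, hw⟩ : d (s x) - s (dP x) ∈ LinearMap.range i := by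
    rw [hexact, LinearMap.mem_ker, map_sub, hdP, hs, sub_self]
  have hB' : B (d (s x)) (i v) = B (s (dP x)) (i v) := by
    rw [← sub_eq_zero, ← LinearMap.sub_apply, ← map_sub, ← hw, hB]
  apply hi
  rw [map_add, hA, hA, ← hdV, hA, hd, hB', hdV]

/-- In an abelian extension `0 → V → E → P → 0`, if a pair `(d_V, d_P)` of
Poisson derivations is inducible then `d_V (μ_x v) = μ_{d_P x} v + μ_x (d_V v)` and
`d_V (ρ_x v) = ρ_{d_P x} v + ρ_x (d_V v)`. -/
theorem inducible_derivation_necessary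
    {k P V E : Type*} [Field k] [CharZero k]
    [AddCommGroup P] [Module k P] [AddCommGroup V] [Module k V]
    [AddCommGroup E] [Module k E]
    (SP : PoissonStruct k P) (SE : PoissonStruct k E)
    (R : PoissonRep k P V SP)
    (i : V →ₗ[k] E) (p : E →ₗ[k] P)
    (hi : Function.Injective i) (hp : Function.Surjective p)
    (hexact : LinearMap.range i = LinearMap.ker p)
    (himul : ∀ u v : V, SE.mul (i u) (i v) = 0)
    (hibra : ∀ u v : V, SE.bra (i u) (i v) = 0)
    (hpmul : ∀ e e' : E, p (SE.mul e e') = SP.mul (p e) (p e'))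
    (hpbra : ∀ e e' : E, p (SE.bra e e') = SP.bra (p e) (p e'))
    (s : P →ₗ[k] E) (hs : ∀ x, p (s x) = x)
    (hact_mu : ∀ (x : P) (v : V), i (R.μ x v) = SE.mul (s x) (i v))
    (hact_rho : ∀ (x : P) (v : V), i (R.ρ x v) = SE.bra (s x) (i v))
    (dV : V →ₗ[k] V) (dP : P →ₗ[k] P) (hdP : IsPoissonDer SP dP)
    (hind : ∃ d : E →ₗ[k] E, IsPoissonDer SE d ∧
        (∀ u, d (i u) = i (dV u)) ∧ (∀ x, p (d (s x)) = dP x)) :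
    (∀ (x : P) (v : V), dV (R.μ x v) = R.μ (dP x) v + R.μ x (dV v)) ∧
    (∀ (x : P) (v : V), dV (R.ρ x v) = R.ρ (dP x) v + R.ρ x (dV v)) := by
  obtain ⟨d, ⟨hdmul, hdbra⟩, hdV, hdP'⟩ := hind
  exact ⟨restrict_apply_action_of_derivation hi hexact himul hs hact_mu hdmul hdV hdP',
    restrict_apply_action_of_derivation hi hexact hibra hs hact_rho hdbra hdV hdP'⟩
end

section
/- Let (P, ·, {,}) be a Poisson algebra, (V, μ, ρ) a representation, and (d_V, d_P) a pair of Poisson derivations of V and P respectively satisfying d_V(μ_x v) = μ_{d_P(x)} v + μ_x d_V(v) and d_V(ρ_x v) = ρ_{d_P(x)} v + ρ_x d_V(v) for all x ∈ P, v ∈ V. If (h, H) is a Poisson 2-cocycle of P with coefficients in (V, μ, ρ), then the pair (h_{(d_V,d_P)}, H_{(d_V,d_P)}) defined by h_{(d_V,d_P)}(x,y) := d_V(h(x,y)) − h(d_P(x), y) − h(x, d_P(y)) and H_{(d_V,d_P)}(x,y) := d_V(H(x,y)) − H(d_P(x), y) − H(x, d_P(y)) is again a Poisson 2-cocycle. 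-/
/-- If `(h, H)` is a Poisson 2-cocycle and `(d_V, d_P)` a compatible pair of
Poisson derivations, then `(h_{(d_V,d_P)}, H_{(d_V,d_P)})` is again a Poisson 2-cocycle. -/
theorem cocycle_transform_by_derivations
    {k P V : Type*} [Field k] [CharZero k]
    [AddCommGroup P] [Module k P] [AddCommGroup V] [Module k V]
    (S : PoissonStruct k P) (R : PoissonRep k P V S)
    (dV : V →ₗ[k] V) (dP : P →ₗ[k] P) (hdP : IsPoissonDer S dP)
    (hcompat_mu : ∀ (x : P) (v : V), dV (R.μ x v) = R.μ (dP x) v + R.μ x (dV v))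
    (hcompat_rho : ∀ (x : P) (v : V), dV (R.ρ x v) = R.ρ (dP x) v + R.ρ x (dV v))
    (h H : P →ₗ[k] P →ₗ[k] V)
    (hc : IsCocycle2 S R.μ R.ρ h H) :
    IsCocycle2 S R.μ R.ρ
      (h.compr₂ dV - h.compl₁₂ dP LinearMap.id - h.compl₁₂ LinearMap.id dP)
      (H.compr₂ dV - H.compl₁₂ dP LinearMap.id - H.compl₁₂ LinearMap.id dP) := by
  obtain ⟨hsymm, halt, hassoc, hjac, hleib⟩ := hc
  obtain ⟨dmul, dbra⟩ := hdP
  have hskew : ∀ x y, H x y + H y x = 0 := fun x y => by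
    simpa [halt] using halt (x + y)
  have apply_eq : ∀ (B : P →ₗ[k] P →ₗ[k] V) (x y : P),
      (B.compr₂ dV - B.compl₁₂ dP LinearMap.id - B.compl₁₂ LinearMap.id dP) x y
        = dV (B x y) - B (dP x) y - B x (dP y) := fun _ _ _ => rfl
  refine ⟨fun x y => ?_, fun x => ?_, fun x y z => ?_, fun x y z => ?_, fun x y z => ?_⟩ <;>
    simp only [apply_eq, map_sub, map_add, LinearMap.add_apply, dmul, dbra]
  · rw [hsymm x y, hsymm (dP x) y, hsymm x (dP y)]
    abel
  · rw [halt, map_zero]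
    linear_combination (norm := module) -hskew (dP x) x
  · have key := congrArg dV (hassoc x y z)
    simp only [map_sub, map_add, map_zero, hcompat_mu] at key
    linear_combination (norm := module) key - hassoc (dP x) y z - hassoc x (dP y) z - hassoc x y (dP z)
  · have key := congrArg dV (hjac x y z)
    simp only [map_add, map_zero, hcompat_rho] at key
    linear_combination (norm := module) key - hjac (dP x) y z - hjac x (dP y) z - hjac x y (dP z)
  · have key := congrArg dV (hleib x y z)
    simp only [map_sub, map_add, map_zero, hcompat_mu, hcompat_rho] at key
    linear_combination (norm := module) key - hleib (dP x) y z - hleib x (dP y) z - hleib x y (dP z)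
end

section
/- Let (P, ·, {,}) be a Poisson algebra, (V, μ, ρ) a representation, and (d_V, d_P) a pair of Poisson derivations of V and P respectively satisfying d_V(μ_x v) = μ_{d_P(x)} v + μ_x d_V(v) and d_V(ρ_x v) = ρ_{d_P(x)} v + ρ_x d_V(v) for all x ∈ P, v ∈ V. If two Poisson 2-cocycles (h, H) and (h', H') are cohomologous via a linear map φ : P → V, then (h_{(d_V,d_P)}, H_{(d_V,d_P)}) and (h'_{(d_V,d_P)}, H'_{(d_V,d_P)}) are cohomologous via the linear map d_V∘φ − φ∘d_P, where h_{(d_V,d_P)}(x,y) := d_V(h(x,y)) − h(d_P(x), y) − h(x, d_P(y)) and H_{(d_V,d_P)}(x,y) := d_V(H(x,y)) − H(d_P(x), y) − H(x, d_P(y)). -/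
/-- If two Poisson 2-cocycles are cohomologous via `φ`, then their
transforms by a compatible pair `(d_V, d_P)` of Poisson derivations are cohomologous
via `d_V ∘ φ − φ ∘ d_P`. -/
theorem cohomologous_transform_by_derivations
    {k P V : Type*} [Field k] [CharZero k]
    [AddCommGroup P] [Module k P] [AddCommGroup V] [Module k V]
    (S : PoissonStruct k P) (R : PoissonRep k P V S)
    (dV : V →ₗ[k] V) (dP : P →ₗ[k] P) (hdP : IsPoissonDer S dP)
    (hcompat_mu : ∀ (x : P) (v : V), dV (R.μ x v) = R.μ (dP x) v + R.μ x (dV v))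
    (hcompat_rho : ∀ (x : P) (v : V), dV (R.ρ x v) = R.ρ (dP x) v + R.ρ x (dV v))
    (h H h' H' : P →ₗ[k] P →ₗ[k] V)
    (hc : IsCocycle2 S R.μ R.ρ h H) (hc' : IsCocycle2 S R.μ R.ρ h' H')
    (φ : P →ₗ[k] V)
    (hφmul : ∀ x y, h x y - h' x y = R.μ x (φ y) - φ (S.mul x y) + R.μ y (φ x))
    (hφbra : ∀ x y, H x y - H' x y = R.ρ x (φ y) - φ (S.bra x y) - R.ρ y (φ x)) :
    (∀ x y,
      (dV (h x y) - h (dP x) y - h x (dP y))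
        - (dV (h' x y) - h' (dP x) y - h' x (dP y))
      = R.μ x (dV (φ y) - φ (dP y))
        - (dV (φ (S.mul x y)) - φ (dP (S.mul x y)))
        + R.μ y (dV (φ x) - φ (dP x))) ∧
    (∀ x y,
      (dV (H x y) - H (dP x) y - H x (dP y))
        - (dV (H' x y) - H' (dP x) y - H' x (dP y))
      = R.ρ x (dV (φ y) - φ (dP y))
        - (dV (φ (S.bra x y)) - φ (dP (S.bra x y)))
        - R.ρ y (dV (φ x) - φ (dP x))) := by
  refine ⟨fun x y => ?_, fun x y => ?_⟩
  · have hd := congrArg dV (hφmul x y)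
    have hx := hφmul (dP x) y
    have hy := hφmul x (dP y)
    simp only [map_sub, map_add, hcompat_mu, hdP.1] at hd ⊢
    rw [sub_sub_sub_comm, sub_sub_sub_comm (dV _), hd, hx, hy]
    abel
  · have hd := congrArg dV (hφbra x y)
    have hx := hφbra (dP x) y
    have hy := hφbra x (dP y)
    simp only [map_sub, map_add, hcompat_rho, hdP.2] at hd ⊢
    rw [sub_sub_sub_comm, sub_sub_sub_comm (dV _), hd, hx, hy]
    abel
end

section
/- Let 0 → V → E → P → 0 be an abelian extension of a Poisson algebra (P, ·, {,}) by a representation (V, μ, ρ), let s be a linear section of p, and let (h, H) be the Poisson 2-cocycle induced by s. Then a pair (d_V, d_P) ∈ Der(V) × Der(P) of Poisson derivations is inducible if and only if d_V(μ_x v) = μ_{d_P(x)} v + μ_x d_V(v) and d_V(ρ_x v) = ρ_{d_P(x)} v + ρ_x d_V(v) for all x ∈ P, v ∈ V, and there exists a linear map φ : P → V such that d_V(h(x,y)) − h(d_P(x),y) − h(x,d_P(y)) = μ_x φ(y) − φ(x·y) + μ_y φ(x) and d_V(H(x,y)) − H(d_P(x),y) − H(x,d_P(y)) = ρ_x φ(y)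 − φ({x,y}) − ρ_y φ(x) for all x,y ∈ P. -/
/-- A linear map killed by `p` factors through an injective `i` with image `ker p`. -/
theorem exists_lift_of_exact {k M V E P : Type*} [Field k]
    [AddCommGroup M] [Module k M] [AddCommGroup V] [Module k V]
    [AddCommGroup E] [Module k E] [AddCommGroup P] [Module k P]
    {i : V →ₗ[k] E} {p : E →ₗ[k] P} (hi : Function.Injective i)
    (hexact : LinearMap.range i = LinearMap.ker p)
    (f : M →ₗ[k] E) (hf : ∀ m, p (f m) = 0) :
    ∃ g : M →ₗ[k] V, ∀ m, i (g m) = f m := by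
  have hr : ∀ m, f m ∈ LinearMap.range i := fun m => by
    rw [hexact, LinearMap.mem_ker, hf]
  refine ⟨(LinearEquiv.ofInjective i hi).symm.toLinearMap ∘ₗ f.codRestrict _ hr, fun m => ?_⟩
  simp

/-- A linear map `d` on an extension by a square-zero ideal, given by `dV` on the ideal and by
`s ∘ dP + i ∘ φ` on the section `s`, is a derivation of a bilinear operation `B` if and only if
`dV` and `dP` are compatible with the left action `l` and the right action `r`, and the
transformed cocycle is the coboundary of `φ`. -/
theorem derivation_iff_of_section {k P V E : Type*} [Field k]
    [AddCommGroup P] [Module k P] [AddCommGroup V] [Module k V]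
    [AddCommGroup E] [Module k E]
    {b : P →ₗ[k] P →ₗ[k] P} {B : E →ₗ[k] E →ₗ[k] E} {l r : P → V → V}
    {i : V →ₗ[k] E} {s : P →ₗ[k] E} (hi : Function.Injective i)
    (hspan : ∀ e, ∃ x v, e = s x + i v)
    (hB : ∀ u v, B (i u) (i v) = 0)
    (hl : ∀ x v, i (l x v) = B (s x) (i v))
    (hr : ∀ x v, i (r x v) = B (i v) (s x))
    {c : P → P → V} (hc : ∀ x y, i (c x y) = B (s x) (s y) - s (b x y))
    {dV : V →ₗ[k] V} {dP : P →ₗ[k] P} {φ : P →ₗ[k] V} {d : E →ₗ[k] E}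
    (hdP : ∀ x y, dP (b x y) = b (dP x) y + b x (dP y))
    (hdi : ∀ u, d (i u) = i (dV u)) (hds : ∀ x, d (s x) = s (dP x) + i (φ x)) :
    (∀ e e', d (B e e') = B (d e) e' + B e (d e')) ↔
      (∀ x v, dV (l x v) = l (dP x) v + l x (dV v)) ∧
      (∀ x v, dV (r x v) = r (dP x) v + r x (dV v)) ∧
      ∀ x y, dV (c x y) - c (dP x) y - c x (dP y) = l x (φ y) - φ (b x y) + r y (φ x) := by
  have hL : ∀ x v, dV (l x v) = l (dP x) v + l x (dV v) ↔
      d (B (s x) (i v)) = B (d (s x)) (i v) + B (s x) (d (i v)) := fun x v => by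
    rw [← hi.eq_iff, ← hl, hdi, hds, hdi]
    simp [hl, hB]
  have hR : ∀ x v, dV (r x v) = r (dP x) v + r x (dV v) ↔
      d (B (i v) (s x)) = B (d (i v)) (s x) + B (i v) (d (s x)) := fun x v => by
    rw [← hi.eq_iff, ← hr, hdi, hds, hdi]
    simp [hr, hB, add_comm]
  have hC : ∀ x y,
      dV (c x y) - c (dP x) y - c x (dP y) = l x (φ y) - φ (b x y) + r y (φ x) ↔
      d (B (s x) (s y)) = B (d (s x)) (s y) + B (s x) (d (s y)) := fun x y => by
    have hsplit : B (s x) (s y) = i (c x y) + s (b x y) := by rw [hc]; abel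
    rw [← hi.eq_iff, hsplit, map_add d, hdi, hds, hds, hds, hdP]
    simp only [map_add, map_sub, LinearMap.add_apply, hl, hr, hc]
    constructor <;> intro e <;> rw [← sub_eq_zero] at e ⊢ <;> rw [← e] <;> abel
  constructor
  · intro hd
    exact ⟨fun x v => (hL x v).2 (hd _ _), fun x v => (hR x v).2 (hd _ _),
      fun x y => (hC x y).2 (hd _ _)⟩
  · rintro ⟨h1, h2, h3⟩ e e'
    obtain ⟨x, u, rfl⟩ := hspan e
    obtain ⟨y, v, rfl⟩ := hspan e'
    have e1 := (hL x v).1 (h1 x v)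
    have e2 := (hR y u).1 (h2 y u)
    have e3 := (hC x y).1 (h3 x y)
    simp only [map_add, LinearMap.add_apply, e1, e2, e3, hB, hdi, map_zero]
    abel

/-- A pair `(d_V, d_P)` of Poisson derivations is inducible iff it is
compatible with the representation and the transformed 2-cocycle
`(h_{(d_V,d_P)}, H_{(d_V,d_P)})` is a coboundary. -/
theorem inducible_derivation_iff
    {k P V E : Type*} [Field k] [CharZero k]
    [AddCommGroup P] [Module k P] [AddCommGroup V] [Module k V]
    [AddCommGroup E] [Module k E]
    (SP : PoissonStruct k P) (SE : PoissonStruct k E)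
    (R : PoissonRep k P V SP)
    (i : V →ₗ[k] E) (p : E →ₗ[k] P)
    (hi : Function.Injective i) (hp : Function.Surjective p)
    (hexact : LinearMap.range i = LinearMap.ker p)
    (himul : ∀ u v : V, SE.mul (i u) (i v) = 0)
    (hibra : ∀ u v : V, SE.bra (i u) (i v) = 0)
    (hpmul : ∀ e e' : E, p (SE.mul e e') = SP.mul (p e) (p e'))
    (hpbra : ∀ e e' : E, p (SE.bra e e') = SP.bra (p e) (p e'))
    (s : P →ₗ[k] E) (hs : ∀ x, p (s x) = x)
    (hact_mu : ∀ (x : P) (v : V), i (R.μ x v) = SE.mul (s x) (i v))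
    (hact_rho : ∀ (x : P) (v : V), i (R.ρ x v) = SE.bra (s x) (i v))
    (h H : P → P → V)
    (hdef : ∀ x y, i (h x y) = SE.mul (s x) (s y) - s (SP.mul x y))
    (Hdef : ∀ x y, i (H x y) = SE.bra (s x) (s y) - s (SP.bra x y))
    (dV : V →ₗ[k] V) (dP : P →ₗ[k] P) (hdP : IsPoissonDer SP dP) :
    (∃ d : E →ₗ[k] E, IsPoissonDer SE d ∧
        (∀ u, d (i u) = i (dV u)) ∧ (∀ x, p (d (s x)) = dP x)) ↔
    ((∀ (x : P) (v : V), dV (R.μ x v) = R.μ (dP x) v + R.μ x (dV v)) ∧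
     (∀ (x : P) (v : V), dV (R.ρ x v) = R.ρ (dP x) v + R.ρ x (dV v)) ∧
     ∃ φ : P →ₗ[k] V, ∀ x y,
        dV (h x y) - h (dP x) y - h x (dP y)
          = R.μ x (φ y) - φ (SP.mul x y) + R.μ y (φ x) ∧
        dV (H x y) - H (dP x) y - H x (dP y)
          = R.ρ x (φ y) - φ (SP.bra x y) - R.ρ y (φ x)) := by
  have hpi : ∀ u, p (i u) = 0 := fun u => by
    rw [← LinearMap.mem_ker, ← hexact]
    exact LinearMap.mem_range_self i u
  obtain ⟨q, hq⟩ := exists_lift_of_exact hi hexact (LinearMap.id - s ∘ₗ p)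
    (fun e => by simp [hs])
  have hq' : ∀ e, i (q e) = e - s (p e) := fun e => by simp [hq]
  have hspan : ∀ e, ∃ x v, e = s x + i v := fun e => ⟨p e, q e, by rw [hq']; abel⟩
  have hmul_iff := fun (d : E →ₗ[k] E) (φ : P →ₗ[k] V) =>
    derivation_iff_of_section (l := fun x v => R.μ x v) (r := fun x v => R.μ x v)
      (dV := dV) (φ := φ) (d := d) hi hspan himul hact_mu
      (fun x v => by rw [SE.mul_comm]; exact hact_mu x v) hdef hdP.1
  have hbra_iff := fun (d : E →ₗ[k] E) (φ : P →ₗ[k] V) =>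
    derivation_iff_of_section (l := fun x v => R.ρ x v) (r := fun x v => -R.ρ x v)
      (dV := dV) (φ := φ) (d := d) hi hspan hibra hact_rho
      (fun x v => by rw [SE.bra_skew, ← hact_rho, map_neg]) Hdef hdP.2
  constructor
  · rintro ⟨d, hd, hdi, hdp⟩
    obtain ⟨φ, hφ⟩ := exists_lift_of_exact hi hexact (d ∘ₗ s - s ∘ₗ dP)
      (fun x => by simp [hs, hdp])
    have hds : ∀ x, d (s x) = s (dP x) + i (φ x) := fun x => by simp [hφ]
    obtain ⟨hμ, -, hc⟩ := (hmul_iff d φ hdi hds).1 hd.1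
    obtain ⟨hρ, -, hC⟩ := (hbra_iff d φ hdi hds).1 hd.2
    exact ⟨hμ, hρ, φ, fun x y => ⟨hc x y, by rw [hC, ← sub_eq_add_neg]⟩⟩
  · rintro ⟨hμ, hρ, φ, hφ⟩
    have hqi : ∀ u, q (i u) = u := fun u => hi (by simp [hq', hpi])
    have hqs : ∀ x, q (s x) = 0 := fun x => hi (by simp [hq', hs])
    let d : E →ₗ[k] E := (s ∘ₗ dP + i ∘ₗ φ) ∘ₗ p + i ∘ₗ dV ∘ₗ q
    have hdi : ∀ u, d (i u) = i (dV u) := fun u => by simp [d, hpi, hqi]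
    have hds : ∀ x, d (s x) = s (dP x) + i (φ x) := fun x => by simp [d, hs, hqs]
    refine ⟨d, ⟨(hmul_iff d φ hdi hds).2 ⟨hμ, hμ, fun x y => (hφ x y).1⟩,
      (hbra_iff d φ hdi hds).2 ⟨hρ, fun x v => ?_, fun x y => ?_⟩⟩, hdi, fun x => ?_⟩
    · rw [map_neg, hρ, neg_add]
    · rw [(hφ x y).2, sub_eq_add_neg]
    · rw [hds, map_add, hs, hpi, add_zero]
end

section
/- Let (P, ·, {,}) be a Poisson algebra and r : P → P an invertible linear map. Then r is a Reynolds operator on P if and only if the map r⁻¹ − Id : P → P is a Poisson derivation, i.e. (r⁻¹ − Id)(x·y) = (r⁻¹ − Id)(x)·y + x·(r⁻¹ − Id)(y) and (r⁻¹ − Id)({x,y}) = {(r⁻¹ − Id)(x), y} + {x, (r⁻¹ − Id)(y)} for all x,y ∈ P. -/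
/-- An invertible linear map is a Reynolds operator for a bilinear product `m` iff
its inverse minus the identity is a derivation of `m`. -/
lemma LinearEquiv.reynolds_iff_symm_sub_id_leibniz {R M : Type*} [CommRing R] [AddCommGroup M]
    [Module R M] (m : M →ₗ[R] M →ₗ[R] M) (r : M ≃ₗ[R] M) :
    (∀ x y, m (r x) (r y) = r (m (r x) y + m x (r y) - m (r x) (r y))) ↔
    (∀ x y, r.symm (m x y) - m x y = m (r.symm x - x) y + m x (r.symm y - y)) := by
  have key (x y : M) : m (r x) (r y) = r (m (r x) y + m x (r y) - m (r x) (r y)) ↔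
      r.symm (m (r x) (r y)) - m (r x) (r y) = m (x - r x) (r y) + m (r x) (y - r y) := by
    rw [← r.symm_apply_eq, map_sub, map_sub, LinearMap.sub_apply, sub_eq_iff_eq_add]
    apply Eq.congr_right
    abel
  simp only [key]
  refine ⟨fun h x y => ?_, fun h x y => ?_⟩
  · simpa using h (r.symm x) (r.symm y)
  · simpa using h (r x) (r y)

/-- An invertible linear map `r` is a Reynolds operator iff
`r⁻¹ − Id` is a Poisson derivation. -/
theorem reynolds_iff_inv_sub_id_derivation
    {k P : Type*} [Field k] [CharZero k] [AddCommGroup P] [Module k P]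
    (S : PoissonStruct k P) (r : P ≃ₗ[k] P) :
    ((∀ x y, S.mul (r x) (r y)
        = r (S.mul (r x) y + S.mul x (r y) - S.mul (r x) (r y))) ∧
     (∀ x y, S.bra (r x) (r y)
        = r (S.bra (r x) y + S.bra x (r y) - S.bra (r x) (r y)))) ↔
    ((∀ x y, r.symm (S.mul x y) - S.mul x y
        = S.mul (r.symm x - x) y + S.mul x (r.symm y - y)) ∧
     (∀ x y, r.symm (S.bra x y) - S.bra x y
        = S.bra (r.symm x - x) y + S.bra x (r.symm y - y))) :=
  and_congr (r.reynolds_iff_symm_sub_id_leibniz S.mul) (r.reynolds_iff_symm_sub_id_leibniz S.bra)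
end

section
/- Let 𝒫 be a Poisson algebra whose underlying vector space is a direct sum P₁ ⊕ P₂ of subspaces (a proto-twilled Poisson algebra), with multiplication ⊙ and bracket {{·,·}}, and let r : P₂ → P₁ be a deformation map, i.e. the graph Gr(r) = {(r(u), u) : u ∈ P₂} is closed under both ⊙ and {{·,·}}. Then the operations on P₂ defined by u ·_r v := pr₂((r(u), u) ⊙ (r(v), v)) and {u, v}_r := pr₂({{(r(u), u), (r(v), v)}}), where pr₂ : P₁ ⊕ P₂ → P₂ is the projection, make P₂ into a Poisson algebra: ·_r is commutative and associative, {·,·}_r is a Lie bracket, and the Leibniz rule {u, v ·_r w}_r = {u,v}_r ·_r w + v ·_r {u,w}_r holds. -/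
/-- If `r : P₂ → P₁` is a deformation map in a proto-twilled Poisson
algebra `𝒫 = P₁ ⊕ P₂` (its graph is closed under both operations), then the projected
operations make `P₂` into a Poisson algebra. -/
theorem deformation_map_induces_poisson
    {k P₁ P₂ : Type*} [Field k] [CharZero k]
    [AddCommGroup P₁] [Module k P₁] [AddCommGroup P₂] [Module k P₂]
    (S : PoissonStruct k (P₁ × P₂)) (r : P₂ →ₗ[k] P₁)
    (hgraph : ∀ a b : P₁ × P₂,
      a ∈ {z : P₁ × P₂ | z.1 = r z.2} → b ∈ {z : P₁ × P₂ | z.1 = r z.2} →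
      S.mul a b ∈ {z : P₁ × P₂ | z.1 = r z.2} ∧
      S.bra a b ∈ {z : P₁ × P₂ | z.1 = r z.2}) :
    IsPoissonOps
      (fun u v : P₂ => (S.mul (r u, u) (r v, v)).2)
      (fun u v : P₂ => (S.bra (r u, u) (r v, v)).2) := by
  have hm (u v : P₂) : (r (S.mul (r u, u) (r v, v)).2, (S.mul (r u, u) (r v, v)).2) =
      S.mul (r u, u) (r v, v) :=
    Prod.ext (hgraph (r u, u) (r v, v) rfl rfl).1.symm rfl
  have hb (u v : P₂) : (r (S.bra (r u, u) (r v, v)).2, (S.bra (r u, u) (r v, v)).2) =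
      S.bra (r u, u) (r v, v) :=
    Prod.ext (hgraph (r u, u) (r v, v) rfl rfl).2.symm rfl
  refine ⟨fun x y => ?_, fun x y z => ?_, fun x => ?_, fun x y z => ?_, fun x y z => ?_⟩
  · exact congrArg Prod.snd (S.mul_comm _ _)
  · simp only [hm]
    exact congrArg Prod.snd (S.mul_assoc _ _ _)
  · exact congrArg Prod.snd (S.bra_alt _)
  · simp only [hb]
    exact congrArg Prod.snd (S.jacobi _ _ _)
  · simp only [hm, hb]
    exact congrArg Prod.snd (S.leibniz _ _ _)
end
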